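/- Let V be a real normed vector space, let k ≥ 0, let F : V → ℝ be a C^∞ function, and let S ⊆ V be a set such that for every m ∈ S and every j with 0 ≤ j ≤ k the j-th iterated Fréchet derivative of F vanishes at m. Then for any C^∞ vector fields X₁, …, X_{k+1} : V → V, any permutation σ of {1,…,k+1}, and any m ∈ S, the iterated directional derivative satisfies (X₁·(X₂·(⋯(X_{k+1}·F))))(m) = (X_{σ(1)}·(X_{σ(2)}·(⋯(X_{σ(k+1)}·F))))(m). -/

import Mathlib

/-- Directional derivative of `g : V → ℝ` along the vector field `X : V → V`:
`(X·g)(p) = Dg(p)(X(p))`. -/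
noncomputable def dirDeriv {V : Type*} [NormedAddCommGroup V] [NormedSpace ℝ V]
    (X : V → V) (g : V → ℝ) : V → ℝ :=
  fun p => fderiv ℝ g p (X p)

/-- Iterated directional derivative: `dirDerivList [X₁, …, Xₙ] g = X₁·(X₂·(⋯(Xₙ·g)))`. -/
noncomputable def dirDerivList {V : Type*} [NormedAddCommGroup V] [NormedSpace ℝ V] :
    List (V → V) → (V → ℝ) → (V → ℝ)
  | [], g => g
  | X :: L, g => dirDeriv X (dirDerivList L g)

theorem dirDeriv_smooth {V : Type*} [NormedAddCommGroup V] [NormedSpace ℝ V]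
    {X : V → V} {g : V → ℝ} (hX : ContDiff ℝ (⊤ : ℕ∞) X) (hg : ContDiff ℝ (⊤ : ℕ∞) g) :
    ContDiff ℝ (⊤ : ℕ∞) (dirDeriv X g) :=
  (hg.fderiv_right (m := (⊤ : ℕ∞)) (by simp)).clm_apply hX

theorem dirDerivList_smooth {V : Type*} [NormedAddCommGroup V] [NormedSpace ℝ V]
    (L : List (V → V)) {g : V → ℝ} (hL : ∀ X ∈ L, ContDiff ℝ (⊤ : ℕ∞) X)
    (hg : ContDiff ℝ (⊤ : ℕ∞) g) :
    ContDiff ℝ (⊤ : ℕ∞) (dirDerivList L g) := by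
  induction L with
  | nil => exact hg
  | cons X L ih =>
    exact dirDeriv_smooth (hL X (by simp)) (ih fun Y hY => hL Y (by simp [hY]))

/-- `g` vanishes at `m` together with its derivatives of order `< n`. -/
def VanishTo {V : Type*} [NormedAddCommGroup V] [NormedSpace ℝ V]
    (m : V) (n : ℕ) (g : V → ℝ) : Prop :=
  ∀ j < n, iteratedFDeriv ℝ j g m = 0

theorem VanishTo.dirDeriv {V : Type*} [NormedAddCommGroup V] [NormedSpace ℝ V]
    {m : V} {n : ℕ} {g : V → ℝ} {X : V → V} (h : VanishTo m n g)
    (hX : ContDiff ℝ (⊤ : ℕ∞) X) (hg : ContDiff ℝ (⊤ : ℕ∞) g) :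
    VanishTo m (n - 1) (dirDeriv X g) := by
  intro j hj
  have hb := norm_iteratedFDeriv_clm_apply (𝕜 := ℝ) (N := (⊤ : ℕ∞)) (n := j)
    (hg.fderiv_right (m := (⊤ : ℕ∞)) (by simp)) hX m (by exact_mod_cast le_top)
  have h0 : ∑ i ∈ Finset.range (j + 1), (j.choose i : ℝ) *
      ‖iteratedFDeriv ℝ i (fderiv ℝ g) m‖ * ‖iteratedFDeriv ℝ (j - i) X m‖ = 0 := by
    apply Finset.sum_eq_zero
    intro i hi
    rw [Finset.mem_range] at hi
    rw [norm_iteratedFDeriv_fderiv, h (i + 1) (by omega)]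
    simp
  rw [h0] at hb
  exact norm_le_zero_iff.mp hb

theorem VanishTo.dirDerivList {V : Type*} [NormedAddCommGroup V] [NormedSpace ℝ V]
    {m : V} {n : ℕ} {g : V → ℝ} (L : List (V → V)) (h : VanishTo m n g)
    (hL : ∀ X ∈ L, ContDiff ℝ (⊤ : ℕ∞) X) (hg : ContDiff ℝ (⊤ : ℕ∞) g) :
    VanishTo m (n - L.length) (dirDerivList L g) := by
  induction L with
  | nil => exact h
  | cons X L ih =>
    have hL' : ∀ Y ∈ L, ContDiff ℝ (⊤ : ℕ∞) Y := fun Y hY => hL Y (by simp [hY])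
    exact (ih hL').dirDeriv (hL X (by simp)) (dirDerivList_smooth L hL' hg)

theorem VanishTo.add {V : Type*} [NormedAddCommGroup V] [NormedSpace ℝ V]
    {m : V} {n : ℕ} {f g : V → ℝ} (h : VanishTo m n f) (h' : VanishTo m n g)
    (hf : ContDiff ℝ (⊤ : ℕ∞) f) (hg : ContDiff ℝ (⊤ : ℕ∞) g) :
    VanishTo m n (f + g) := by
  intro j hj
  rw [iteratedFDeriv_add_apply (hf.contDiffAt.of_le (by exact_mod_cast le_top))
    (hg.contDiffAt.of_le (by exact_mod_cast le_top)), h j hj, h' j hj, add_zero]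

theorem dirDeriv_sub {V : Type*} [NormedAddCommGroup V] [NormedSpace ℝ V]
    {X : V → V} {f g : V → ℝ}
    (hf : ContDiff ℝ (⊤ : ℕ∞) f) (hg : ContDiff ℝ (⊤ : ℕ∞) g) :
    dirDeriv X f - dirDeriv X g = dirDeriv X (f - g) := by
  funext p
  simp only [dirDeriv, Pi.sub_apply]
  rw [fderiv_sub (hf.differentiable (by simp) p) (hg.differentiable (by simp) p)]
  rfl

theorem dirDeriv_comm_sub {V : Type*} [NormedAddCommGroup V] [NormedSpace ℝ V]
    {X Y : V → V} {g : V → ℝ} (hX : ContDiff ℝ (⊤ : ℕ∞) X) (hY : ContDiff ℝ (⊤ : ℕ∞) Y)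
    (hg : ContDiff ℝ (⊤ : ℕ∞) g) :
    dirDeriv X (dirDeriv Y g) - dirDeriv Y (dirDeriv X g)
      = dirDeriv (VectorField.lieBracket ℝ X Y) g := by
  funext p
  have hd : DifferentiableAt ℝ (fderiv ℝ g) p :=
    (hg.fderiv_right (m := (⊤ : ℕ∞)) (by simp)).differentiable (by simp) p
  have hs : IsSymmSndFDerivAt ℝ g p := hg.contDiffAt.isSymmSndFDerivAt (by
    rw [minSmoothness_of_isRCLikeNormedField]
    exact WithTop.coe_le_coe.2 (le_top : (2 : ℕ∞) ≤ ⊤))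
  have e (Z W : V → V) (hW : ContDiff ℝ (⊤ : ℕ∞) W) : dirDeriv Z (dirDeriv W g) p =
      fderiv ℝ (fderiv ℝ g) p (Z p) (W p) + fderiv ℝ g p (fderiv ℝ W p (Z p)) := by
    have := fderiv_clm_apply hd (hW.differentiable (by simp) p)
    unfold dirDeriv
    rw [this]
    simp [add_comm]
  rw [Pi.sub_apply, e X Y hY, e Y X hX, hs.eq (X p) (Y p)]
  simp [dirDeriv, VectorField.lieBracket]

theorem vanishTo_perm {V : Type*} [NormedAddCommGroup V] [NormedSpace ℝ V]
    {m : V} {n : ℕ} {F : V → ℝ} (h : VanishTo m n F) (hF : ContDiff ℝ (⊤ : ℕ∞) F)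
    {L L' : List (V → V)} (hp : L.Perm L') (hL : ∀ X ∈ L, ContDiff ℝ (⊤ : ℕ∞) X) :
    VanishTo m (n + 1 - L.length) (dirDerivList L F - dirDerivList L' F) := by
  induction hp with
  | nil =>
    intro j hj
    rw [sub_self]
    simp [Pi.zero_def]
  | @cons X L L' hp ih =>
    have hL₁ : ∀ Y ∈ L, ContDiff ℝ (⊤ : ℕ∞) Y := fun Y hY => hL Y (by simp [hY])
    have hL₂ : ∀ Y ∈ L', ContDiff ℝ (⊤ : ℕ∞) Y := fun Y hY => hL₁ Y (hp.mem_iff.mpr hY)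
    have s₁ := dirDerivList_smooth L hL₁ hF
    have s₂ := dirDerivList_smooth L' hL₂ hF
    have := (ih hL₁).dirDeriv (hL X (by simp)) (s₁.sub s₂)
    simp only [dirDerivList]
    rw [dirDeriv_sub s₁ s₂]
    exact this
  | swap X Y L =>
    have hL₁ : ∀ Y ∈ L, ContDiff ℝ (⊤ : ℕ∞) Y := fun Y hY => hL Y (by simp [hY])
    have s₁ := dirDerivList_smooth L hL₁ hF
    have hX := hL X (by simp)
    have hY := hL Y (by simp)
    have hB : ContDiff ℝ (⊤ : ℕ∞) (VectorField.lieBracket ℝ Y X) :=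
      hY.lieBracket_vectorField hX (by simp)
    simp only [dirDerivList]
    rw [dirDeriv_comm_sub hY hX s₁]
    have := (h.dirDerivList L hL₁ hF).dirDeriv hB s₁
    intro j hj
    apply this
    simp only [List.length_cons] at hj
    omega
  | @trans L₁ L₂ L₃ h₁ h₂ ih₁ ih₂ =>
    have hL₂ : ∀ Y ∈ L₂, ContDiff ℝ (⊤ : ℕ∞) Y := fun Y hY => hL Y (h₁.mem_iff.mpr hY)
    have hL₃ : ∀ Y ∈ L₃, ContDiff ℝ (⊤ : ℕ∞) Y := fun Y hY => hL₂ Y (h₂.mem_iff.mpr hY)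
    have s₁ := dirDerivList_smooth L₁ hL hF
    have s₂ := dirDerivList_smooth L₂ hL₂ hF
    have s₃ := dirDerivList_smooth L₃ hL₃ hF
    have a := ih₁ hL
    have b := ih₂ hL₂
    rw [← h₁.length_eq] at b
    have := a.add b (s₁.sub s₂) (s₂.sub s₃)
    rwa [sub_add_sub_cancel] at this

/-- If `F` is `C^∞` and all its iterated Fréchet derivatives of order `≤ k` vanish on `S`,
then the `(k+1)`-fold iterated directional derivative of `F` at a point of `S` is symmetric
in the vector fields. -/
theorem iterated_dirDeriv_perm_invariant
    {V : Type*} [NormedAddCommGroup V] [NormedSpace ℝ V]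
    (k : ℕ) (F : V → ℝ) (hF : ContDiff ℝ (⊤ : ℕ∞) F) (S : Set V)
    (hS : ∀ m ∈ S, ∀ j ≤ k, iteratedFDeriv ℝ j F m = 0)
    (X : Fin (k + 1) → V → V) (hX : ∀ i, ContDiff ℝ (⊤ : ℕ∞) (X i))
    (σ : Equiv.Perm (Fin (k + 1))) (m : V) (hm : m ∈ S) :
    dirDerivList (List.ofFn X) F m = dirDerivList (List.ofFn fun i => X (σ i)) F m := by
  have hv : VanishTo m (k + 1) F := fun j hj => hS m hm j (by omega)
  have hp : (List.ofFn X).Perm (List.ofFn fun i => X (σ i)) :=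
    (Equiv.Perm.ofFn_comp_perm σ X).symm
  have := vanishTo_perm hv hF hp (by
    intro Y hY
    obtain ⟨i, rfl⟩ := List.mem_ofFn.mp hY
    exact hX i) 0 (by simp)
  have h0 := congrArg (fun f => f 0) this
  simp only [iteratedFDeriv_zero_apply] at h0
  exact sub_eq_zero.mp h0
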